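/- Fix an angle φ with π/6 < φ < π/2, an integer k, a constant C > 0, and a compact set K ⊂ ℂ. Let Π : ℝ → ℂ be the path Π(s) = −e^{−iφ}·s for s ≤ −1, Π(s) = cos φ + i·s·sin φ for −1 ≤ s ≤ 1, and Π(s) = e^{iφ}·s for s ≥ 1, with piecewise derivative Π'(s) equal to −e^{−iφ}, i·sin φ, e^{iφ} on the respective pieces. Then there exists M > 0 such that for every measurable function f : ℂ → ℂ satisfying ‖f(t)‖ ≤ C·‖t‖^k for all t in the image of Π, and for every z ∈ K: the function s ↦ f(Π(s))·exp(−z·Π(s) + Π(s)³/3)·Π'(s) is integrable on ℝ, and ‖∫_ℝ f(Π(s))·exp(−z·Π(s) + Π(s)³/3)·Π'(s) ds‖ ≤ M. -/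

import Mathlib

/-- The contour `Π(φ)`: three line segments going from `∞·e^{-iφ}` to `∞·e^{iφ}`. -/
noncomputable def airyPath (φ : ℝ) (s : ℝ) : ℂ :=
  if s ≤ -1 then -Complex.exp (-(φ : ℂ) * Complex.I) * (s : ℂ)
  else if s ≤ 1 then (Real.cos φ : ℂ) + Complex.I * (s : ℂ) * (Real.sin φ : ℂ)
  else Complex.exp ((φ : ℂ) * Complex.I) * (s : ℂ)

/-- The piecewise derivative of the contour `Π(φ)`. -/
noncomputable def airyPathDeriv (φ : ℝ) (s : ℝ) : ℂ :=
  if s ≤ -1 then -Complex.exp (-(φ : ℂ) * Complex.I)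
  else if s ≤ 1 then Complex.I * (Real.sin φ : ℂ)
  else Complex.exp ((φ : ℂ) * Complex.I)

open MeasureTheory

lemma measurable_airyPath (φ : ℝ) : Measurable (airyPath φ) := by
  unfold airyPath
  refine Measurable.ite measurableSet_Iic (by fun_prop) ?_
  exact Measurable.ite measurableSet_Iic (by fun_prop) (by fun_prop)

lemma measurable_airyPathDeriv (φ : ℝ) : Measurable (airyPathDeriv φ) := by
  unfold airyPathDeriv
  refine Measurable.ite measurableSet_Iic (by fun_prop) ?_
  exact Measurable.ite measurableSet_Iic (by fun_prop) (by fun_prop)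

lemma norm_airyPathDeriv_le (φ s : ℝ) : ‖airyPathDeriv φ s‖ ≤ 1 := by
  unfold airyPathDeriv
  split_ifs
  · rw [norm_neg, ← Complex.ofReal_neg, Complex.norm_exp_ofReal_mul_I]
  · rw [norm_mul, Complex.norm_I, one_mul, Complex.norm_real]
    exact Real.abs_sin_le_one φ
  · rw [Complex.norm_exp_ofReal_mul_I]

lemma norm_airyPath_le (φ s : ℝ) : ‖airyPath φ s‖ ≤ 1 + |s| := by
  unfold airyPath
  split_ifs
  · rw [norm_mul, norm_neg, ← Complex.ofReal_neg, Complex.norm_exp_ofReal_mul_I,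
      Complex.norm_real, Real.norm_eq_abs]
    linarith
  · refine (norm_add_le _ _).trans (add_le_add ?_ ?_)
    · rw [Complex.norm_real]
      exact Real.abs_cos_le_one φ
    · rw [norm_mul, norm_mul, Complex.norm_I, one_mul, Complex.norm_real, Complex.norm_real]
      exact mul_le_of_le_one_right (norm_nonneg s) (Real.abs_sin_le_one φ)
  · rw [norm_mul, Complex.norm_exp_ofReal_mul_I, Complex.norm_real, Real.norm_eq_abs]
    linarith

lemma cos_le_norm_airyPath (φ s : ℝ) : Real.cos φ ≤ ‖airyPath φ s‖ := by
  unfold airyPath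
  split_ifs with h₁ h₂
  · rw [norm_mul, norm_neg, ← Complex.ofReal_neg, Complex.norm_exp_ofReal_mul_I,
      Complex.norm_real, Real.norm_eq_abs, one_mul]
    linarith [Real.cos_le_one φ, neg_le_abs s]
  · refine le_trans (le_of_eq ?_) (Complex.re_le_norm _)
    simp [-Complex.ofReal_cos, -Complex.ofReal_sin]
  · rw [norm_mul, Complex.norm_exp_ofReal_mul_I, Complex.norm_real, Real.norm_eq_abs, one_mul]
    linarith [Real.cos_le_one φ, le_abs_self s]

lemma re_exp_mul_I_mul_cube_div_three (φ r : ℝ) :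
    ((Complex.exp (φ * Complex.I) * r) ^ 3 / 3).re = Real.cos (3 * φ) / 3 * r ^ 3 := by
  have h : (Complex.exp (φ * Complex.I) * r) ^ 3 / 3
      = ((r ^ 3 / 3 : ℝ) : ℂ) * Complex.exp ((3 * φ : ℝ) * Complex.I) := by
    rw [mul_pow, ← Complex.exp_nat_mul]
    push_cast
    ring_nf
  rw [h, Complex.re_ofReal_mul, Complex.exp_ofReal_mul_I_re]
  ring

lemma re_airyPath_cube_div_three_le (φ s : ℝ) (hφ : 0 ≤ Real.cos φ) :
    ((airyPath φ s) ^ 3 / 3).re ≤ Real.cos (3 * φ) / 3 * |s| ^ 3 + 1 := by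
  unfold airyPath
  split_ifs with h₁ h₂
  · have h : -Complex.exp (-(φ : ℂ) * Complex.I) * (s : ℂ)
        = Complex.exp ((-φ : ℝ) * Complex.I) * (-s : ℝ) := by
      push_cast
      ring
    rw [h, re_exp_mul_I_mul_cube_div_three, mul_neg, Real.cos_neg, abs_of_nonpos (by linarith)]
    linarith
  · have h : (((Real.cos φ : ℂ) + Complex.I * s * Real.sin φ) ^ 3 / 3).re
        = Real.cos φ ^ 3 / 3 - Real.cos φ * (s * Real.sin φ) ^ 2 := by
      have : ((Real.cos φ : ℂ) + Complex.I * s * Real.sin φ) ^ 3 / 3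
          = ((Real.cos φ ^ 3 / 3 - Real.cos φ * (s * Real.sin φ) ^ 2 : ℝ) : ℂ)
            + ((Real.cos φ ^ 2 * (s * Real.sin φ) - (s * Real.sin φ) ^ 3 / 3 : ℝ) : ℂ)
              * Complex.I := by
        push_cast
        linear_combination (Complex.cos φ * (s * Complex.sin φ) ^ 2
          + (s * Complex.sin φ) ^ 3 / 3 * Complex.I) * Complex.I_sq
      rw [this]
      simp [-Complex.ofReal_cos, -Complex.ofReal_sin, -Complex.ofReal_sub, -Complex.ofReal_mul,
        -Complex.ofReal_div, -Complex.ofReal_pow]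
    rw [h]
    have hs : |s| ^ 3 ≤ 1 := pow_le_one₀ (abs_nonneg s) (abs_le.mpr ⟨by linarith, h₂⟩)
    have hc : Real.cos φ ^ 3 ≤ 1 := pow_le_one₀ hφ (Real.cos_le_one φ)
    have h0 : 0 ≤ Real.cos φ * (s * Real.sin φ) ^ 2 := by positivity
    nlinarith [Real.neg_one_le_cos (3 * φ), pow_nonneg (abs_nonneg s) 3]
  · rw [re_exp_mul_I_mul_cube_div_three, abs_of_pos (by linarith)]
    linarith

lemma cos_three_mul_neg {φ : ℝ} (h₁ : Real.pi / 6 < φ) (h₂ : φ < Real.pi / 2) :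
    Real.cos (3 * φ) < 0 :=
  Real.cos_neg_of_pi_div_two_lt_of_lt (by linarith) (by linarith)

lemma zpow_le_exp {x a b : ℝ} (hx : 0 < x) (k : ℤ) (ha : x ≤ Real.exp a)
    (hb : x⁻¹ ≤ Real.exp b) (ha0 : 0 ≤ a) (hb0 : 0 ≤ b) :
    x ^ k ≤ Real.exp (k.natAbs * (a + b)) := by
  rw [Real.exp_nat_mul]
  rcases Int.natAbs_eq k with h | h
  · rw [h, zpow_natCast, Int.natAbs_natCast]
    exact pow_le_pow_left₀ hx.le (ha.trans (Real.exp_le_exp.mpr (by linarith))) _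
  · rw [h, zpow_neg, zpow_natCast, Int.natAbs_neg, Int.natAbs_natCast, ← inv_pow]
    exact pow_le_pow_left₀ (by positivity) (hb.trans (Real.exp_le_exp.mpr (by linarith))) _

lemma exists_forall_mul_sub_mul_cube_le (a : ℝ) {δ : ℝ} (hδ : 0 < δ) (ha : 0 ≤ a) :
    ∃ B : ℝ, ∀ x : ℝ, 0 ≤ x → a * x - δ * x ^ 3 ≤ B - x := by
  set m := 1 + (a + 1) / δ with hm
  have hq : 0 ≤ (a + 1) / δ := by positivity
  have hδm : a + 1 ≤ δ * m := by
    rw [hm, mul_add, mul_div_cancel₀ _ hδ.ne']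
    linarith
  refine ⟨2 * δ * m ^ 3, fun x hx => ?_⟩
  have hm1 : 1 ≤ m := by linarith
  have h1 : 0 ≤ δ * ((x - m) ^ 2 * (x + 2 * m)) := by positivity
  have h2 : (a + 1) * x ≤ δ * m * (3 * m) * x := by
    have : a + 1 ≤ δ * m * (3 * m) := by nlinarith
    exact mul_le_mul_of_nonneg_right this hx
  nlinarith

lemma integrable_exp_neg_abs : Integrable (fun s : ℝ => Real.exp (-|s|)) := by
  rw [← integrableOn_univ, ← Set.Iic_union_Ioi (a := (0 : ℝ))]
  refine IntegrableOn.union ?_ ?_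
  · refine (integrableOn_exp_Iic 0).congr_fun (fun s hs => ?_) measurableSet_Iic
    simp [abs_of_nonpos (Set.mem_Iic.mp hs)]
  · refine (integrableOn_exp_neg_Ioi 0).congr_fun (fun s hs => ?_) measurableSet_Ioi
    simp [abs_of_pos (Set.mem_Ioi.mp hs)]

lemma exists_norm_airy_integrand_le {φ : ℝ} (hφ₁ : Real.pi / 6 < φ) (hφ₂ : φ < Real.pi / 2)
    (k : ℤ) {C : ℝ} (hC : 0 < C) {R : ℝ} (hR : 0 ≤ R) :
    ∃ A > 0, ∀ (f : ℂ → ℂ) (s : ℝ) (z : ℂ), ‖z‖ ≤ R →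
      ‖f (airyPath φ s)‖ ≤ C * ‖airyPath φ s‖ ^ k →
      ‖f (airyPath φ s) * Complex.exp (-z * airyPath φ s + (airyPath φ s) ^ 3 / 3) *
        airyPathDeriv φ s‖ ≤ A * Real.exp (-|s|) := by
  have hcos : 0 < Real.cos φ :=
    Real.cos_pos_of_mem_Ioo ⟨by linarith [Real.pi_pos], hφ₂⟩
  have h3 := cos_three_mul_neg hφ₁ hφ₂
  set b := (Real.cos φ)⁻¹
  have hb0 : 0 < b := inv_pos.mpr hcos
  obtain ⟨B, hB⟩ := exists_forall_mul_sub_mul_cube_le (k.natAbs + R)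
    (δ := -(Real.cos (3 * φ) / 3)) (by linarith) (by positivity)
  refine ⟨C * Real.exp (k.natAbs * b + R + 1 + B), by positivity, fun f s z hz hf => ?_⟩
  have hle := norm_airyPath_le φ s
  have hge := cos_le_norm_airyPath φ s
  have hpow : ‖airyPath φ s‖ ^ k ≤ Real.exp (k.natAbs * (|s| + b)) := by
    refine zpow_le_exp (hcos.trans_le hge) k ?_ ?_ (abs_nonneg s) hb0.le
    · linarith [Real.add_one_le_exp |s|]
    · exact (inv_anti₀ hcos hge).trans (by linarith [Real.add_one_le_exp b])
  have hre : (-z * airyPath φ s + (airyPath φ s) ^ 3 / 3).re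
      ≤ R * (1 + |s|) + (Real.cos (3 * φ) / 3 * |s| ^ 3 + 1) := by
    rw [Complex.add_re]
    refine add_le_add ((Complex.re_le_norm _).trans ?_)
      (re_airyPath_cube_div_three_le φ s hcos.le)
    rw [norm_mul, norm_neg]
    exact mul_le_mul hz hle (norm_nonneg _) hR
  rw [norm_mul, norm_mul, Complex.norm_exp]
  calc _ ≤ C * Real.exp (k.natAbs * (|s| + b)) *
        Real.exp (R * (1 + |s|) + (Real.cos (3 * φ) / 3 * |s| ^ 3 + 1)) * 1 := by
        gcongr
        · exact hf.trans (by gcongr)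
        · exact norm_airyPathDeriv_le φ s
    _ ≤ _ := by
        rw [mul_one, mul_assoc, mul_assoc, ← Real.exp_add, ← Real.exp_add]
        refine mul_le_mul_of_nonneg_left (Real.exp_le_exp.mpr ?_) hC.le
        have := hB |s| (abs_nonneg s)
        linarith

/-- For `π/6 < φ < π/2` and any function `f` with `‖f(t)‖ ≤ C‖t‖^k` on the contour
`Π(φ)`, the integral `∫_{Π(φ)} f(t) e^{-zt + t³/3} dt` converges and is bounded
uniformly for `z` in any compact set. -/
theorem airy_type_integral_bounded (φ : ℝ) (hφ₁ : Real.pi / 6 < φ) (hφ₂ : φ < Real.pi / 2)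
    (k : ℤ) (C : ℝ) (hC : 0 < C) (K : Set ℂ) (hK : IsCompact K) :
    ∃ M > (0 : ℝ), ∀ f : ℂ → ℂ, Measurable f →
      (∀ s : ℝ, ‖f (airyPath φ s)‖ ≤ C * ‖airyPath φ s‖ ^ k) →
      ∀ z ∈ K,
        MeasureTheory.Integrable (fun s : ℝ =>
          f (airyPath φ s) *
            Complex.exp (-z * airyPath φ s + (airyPath φ s) ^ 3 / 3) *
            airyPathDeriv φ s) ∧
        ‖∫ s : ℝ, f (airyPath φ s) *
            Complex.exp (-z * airyPath φ s + (airyPath φ s) ^ 3 / 3) *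
            airyPathDeriv φ s‖ ≤ M := by
  obtain ⟨R, hR⟩ := hK.isBounded.exists_norm_le
  obtain ⟨A, hA, hbound⟩ := exists_norm_airy_integrand_le hφ₁ hφ₂ k hC (le_max_right R 0)
  have hg : Integrable (fun s : ℝ => A * Real.exp (-|s|)) := integrable_exp_neg_abs.const_mul A
  refine ⟨(∫ s : ℝ, A * Real.exp (-|s|)) + 1,
    add_pos_of_nonneg_of_pos (integral_nonneg fun s => by positivity) one_pos,
    fun f hf hfC z hz => ?_⟩
  have hle := fun s => hbound f s z ((hR z hz).trans (le_max_left R 0)) (hfC s)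
  have hmeas := measurable_airyPath φ
  have hmeas' := measurable_airyPathDeriv φ
  refine ⟨hg.mono' (Measurable.aestronglyMeasurable (by fun_prop)) (.of_forall hle), ?_⟩
  exact (norm_integral_le_of_norm_le hg (.of_forall hle)).trans (by linarith)
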